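/- Let K and ΔK be symmetric (m+n)×(m+n) real matrices, let ε ≥ 0, and let L̃ be an (m+n)×(m+n) lower triangular real matrix with positive diagonal entries such that K + ΔK = L̃·J_{m+n}·L̃ᵀ and |ΔK| ≤ ε·|L̃|·|L̃ᵀ| entrywise. If cond_F(L̃) · cond_F(L̃⁻ᵀ) · ε < 1/2, then there exists an (m+n)×(m+n) real matrix ΔL such that L̃ − ΔL is lower triangular with positive diagonal entries and K = (L̃ − ΔL)·J_{m+n}·(L̃ − ΔL)ᵀ. -/

import Mathlib

open Matrix

noncomputable def frobNorm {k : ℕ} (A : Matrix (Fin k) (Fin k) ℝ) : ℝ :=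
  Real.sqrt (∑ i, ∑ j, (A i j) ^ 2)

noncomputable def specNorm {k : ℕ} (A : Matrix (Fin k) (Fin k) ℝ) : ℝ :=
  ‖Matrix.toEuclideanCLM (𝕜 := ℝ) A‖

noncomputable def kappa2 {k : ℕ} (A : Matrix (Fin k) (Fin k) ℝ) : ℝ :=
  specNorm A⁻¹ * specNorm A

noncomputable def upTri {k : ℕ} (A : Matrix (Fin k) (Fin k) ℝ) : Matrix (Fin k) (Fin k) ℝ :=
  Matrix.of fun i j => if i < j then A i j else if i = j then A i i / 2 else 0

noncomputable def Jmat (m n : ℕ) : Matrix (Fin (m + n)) (Fin (m + n)) ℝ :=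
  Matrix.diagonal fun i => if (i : ℕ) < m then 1 else -1

def IsLowerTri {k : ℕ} (A : Matrix (Fin k) (Fin k) ℝ) : Prop :=
  ∀ i j, i < j → A i j = 0

def IsUpperTri {k : ℕ} (A : Matrix (Fin k) (Fin k) ℝ) : Prop :=
  ∀ i j, j < i → A i j = 0

def PosDiag {k : ℕ} (A : Matrix (Fin k) (Fin k) ℝ) : Prop :=
  ∀ i, 0 < A i i

noncomputable def entAbs {k : ℕ} (A : Matrix (Fin k) (Fin k) ℝ) : Matrix (Fin k) (Fin k) ℝ :=
  Matrix.of fun i j => |A i j|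

noncomputable def condF {k : ℕ} (A : Matrix (Fin k) (Fin k) ℝ) : ℝ :=
  frobNorm (entAbs A⁻¹ * entAbs A)

lemma frobNorm_nonneg {k : ℕ} (A : Matrix (Fin k) (Fin k) ℝ) : 0 ≤ frobNorm A :=
  Real.sqrt_nonneg _

lemma frobNorm_sq {k : ℕ} (A : Matrix (Fin k) (Fin k) ℝ) :
    frobNorm A ^ 2 = ∑ i, ∑ j, (A i j) ^ 2 :=
  Real.sq_sqrt (by positivity)

section Frobenius

attribute [local instance] Matrix.frobeniusNormedAddCommGroup

lemma frobNorm_mul_le {k : ℕ} (A B : Matrix (Fin k) (Fin k) ℝ) :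
    frobNorm (A * B) ≤ frobNorm A * frobNorm B := by
  have h (C : Matrix (Fin k) (Fin k) ℝ) : frobNorm C = ‖C‖ := by
    simp [frobNorm, Matrix.frobenius_norm_def, Real.sqrt_eq_rpow]
  simpa only [h] using Matrix.frobenius_norm_mul A B

end Frobenius

lemma frobNorm_le_of_abs_le {k : ℕ} {A B : Matrix (Fin k) (Fin k) ℝ} {c : ℝ} (hc : 0 ≤ c)
    (h : ∀ i j, |A i j| ≤ c * B i j) : frobNorm A ≤ c * frobNorm B := by
  refine abs_le_of_sq_le_sq' ?_ (mul_nonneg hc (frobNorm_nonneg B)) |>.2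
  rw [mul_pow, frobNorm_sq, frobNorm_sq, Finset.mul_sum]
  refine Finset.sum_le_sum fun i _ => ?_
  rw [Finset.mul_sum]
  refine Finset.sum_le_sum fun j _ => ?_
  rw [← mul_pow, ← sq_abs (A i j)]
  exact pow_le_pow_left₀ (abs_nonneg _) (h i j) 2

lemma abs_mul_apply_le {k : ℕ} (A B : Matrix (Fin k) (Fin k) ℝ) (i j : Fin k) :
    |(A * B) i j| ≤ (entAbs A * entAbs B) i j := by
  simp only [mul_apply, entAbs, of_apply, ← abs_mul]
  exact Finset.abs_sum_le_sum_abs _ _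

lemma mul_apply_le_mul_apply {k : ℕ} {A B C D : Matrix (Fin k) (Fin k) ℝ}
    (hC : ∀ i j, 0 ≤ C i j) (hB : ∀ i j, 0 ≤ B i j)
    (hAC : ∀ i j, A i j ≤ C i j) (hBD : ∀ i j, B i j ≤ D i j) (i j : Fin k) :
    (A * B) i j ≤ (C * D) i j := by
  simp only [mul_apply]
  exact Finset.sum_le_sum fun l _ => mul_le_mul (hAC i l) (hBD l j) (hB l j) (hC i l)

lemma entAbs_nonneg {k : ℕ} (A : Matrix (Fin k) (Fin k) ℝ) (i j : Fin k) : 0 ≤ entAbs A i j :=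
  abs_nonneg _

/-- The bilinear form of a matrix, twisted by a sign vector, is bounded by its Frobenius norm. -/
lemma sum_sign_mul_le {k : ℕ} (s : Fin k → ℝ) (hs : ∀ i, s i ^ 2 = 1)
    (E : Matrix (Fin k) (Fin k) ℝ) (x : Fin k → ℝ) :
    ∑ i, s i * x i * (E *ᵥ x) i ≤ frobNorm E * ∑ i, x i ^ 2 := by
  have hx : (0 : ℝ) ≤ ∑ i, x i ^ 2 := by positivity
  refine abs_le_of_sq_le_sq' ?_ (mul_nonneg (frobNorm_nonneg E) hx) |>.2
  have h := Finset.sum_mul_sq_le_sq_mul_sq Finset.univ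
    (fun p : Fin k × Fin k => E p.1 p.2) (fun p => s p.1 * x p.1 * x p.2)
  simp only [Fintype.sum_prod_type] at h
  calc _ = (∑ i, ∑ j, E i j * (s i * x i * x j)) ^ 2 := by
        congr 1
        refine Finset.sum_congr rfl fun i _ => ?_
        simp only [mulVec, dotProduct, Finset.mul_sum]
        exact Finset.sum_congr rfl fun j _ => by ring
    _ ≤ _ := h
    _ = _ := by
        simp only [mul_pow, hs, one_mul, frobNorm_sq]
        rw [sq (∑ i, x i ^ 2), Finset.sum_mul_sum _ _ (fun i => x i ^ 2)]

/-- A symmetric matrix `A` such that `diagonal s * A` has positive definite symmetric part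
admits a generalized Cholesky factorization with signature `s`. -/
lemma exists_generalized_cholesky {k : ℕ} (s : Fin k → ℝ) (hs : ∀ i, s i ^ 2 = 1)
    (A : Matrix (Fin k) (Fin k) ℝ) (hA : ∀ i j, A i j = A j i)
    (hpos : ∀ x : Fin k → ℝ, x ≠ 0 → 0 < ∑ i, s i * x i * (A *ᵥ x) i) :
    ∃ M : Matrix (Fin k) (Fin k) ℝ,
      IsLowerTri M ∧ PosDiag M ∧ A = M * diagonal s * Mᵀ := by
  induction k with
  | zero => exact ⟨0, fun i => i.elim0, fun i => i.elim0, Matrix.ext fun i => i.elim0⟩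
  | succ k ih =>
    have ha : 0 < s 0 * A 0 0 := by
      have h := hpos (Pi.single 0 1) (by simp)
      simpa [Fin.sum_univ_succ, mulVec_single_one] using h
    have hA0 : A 0 0 ≠ 0 := right_ne_zero_of_mul ha.ne'
    obtain ⟨M, hM, hMd, hfac⟩ := ih (fun i => s i.succ) (fun i => hs i.succ)
      (of fun i j => A i.succ j.succ - A i.succ 0 * A j.succ 0 / A 0 0)
      (fun i j => by simp only [of_apply, hA i.succ j.succ]; ring)
      (fun y hy => by
        have hx : (Fin.cons (-(∑ j, A j.succ 0 * y j) / A 0 0) y : Fin (k + 1) → ℝ) ≠ 0 := by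
          intro h
          exact hy (funext fun i => by simpa using congrFun h i.succ)
        have h := hpos _ hx
        have h0 : (A *ᵥ (Fin.cons (-(∑ j, A j.succ 0 * y j) / A 0 0) y : Fin (k + 1) → ℝ)) 0
            = 0 := by
          simp only [mulVec, dotProduct, Fin.sum_univ_succ, Fin.cons_zero, Fin.cons_succ]
          rw [mul_div_cancel₀ _ hA0]
          simp only [hA 0 (Fin.succ _)]
          ring
        rw [Fin.sum_univ_succ, h0, mul_zero, zero_add] at h
        refine h.trans_eq (Finset.sum_congr rfl fun i _ => ?_)
        simp only [Fin.cons_succ]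
        congr 1
        simp only [mulVec, dotProduct, Fin.sum_univ_succ, Fin.cons_zero, Fin.cons_succ, of_apply,
          sub_mul, Finset.sum_sub_distrib]
        have : A i.succ 0 * (-(∑ j, A j.succ 0 * y j) / A 0 0)
            = -∑ j, A i.succ 0 * A j.succ 0 / A 0 0 * y j := by
          rw [neg_div, mul_neg, Finset.sum_div, Finset.mul_sum]
          congr 1
          exact Finset.sum_congr rfl fun j _ => by ring
        rw [this]
        ring)
    set r := Real.sqrt (s 0 * A 0 0) with hr
    have hr0 : 0 < r := Real.sqrt_pos.2 ha
    have hrr : r * r = s 0 * A 0 0 := Real.mul_self_sqrt ha.le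
    have hs0 : s 0 * s 0 = 1 := by rw [← sq]; exact hs 0
    have hsr : s 0 * (r * r) = A 0 0 := by rw [hrr, ← mul_assoc, hs0, one_mul]
    have hfac' (i j : Fin k) : A i.succ j.succ - A i.succ 0 * A j.succ 0 / A 0 0
        = ∑ l, M i l * s l.succ * M j l := by
      have h := congrFun (congrFun hfac i) j
      rw [mul_apply] at h
      simpa only [mul_diagonal, transpose_apply, of_apply] using h
    refine ⟨of (Fin.cons (Fin.cons r 0) fun i => Fin.cons (s 0 * A i.succ 0 / r) (M i)),
      ?_, ?_, ?_⟩
    · intro i j hij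
      induction i using Fin.cases <;> induction j using Fin.cases
      · simp at hij
      · simp
      · simp at hij
      · simpa using hM _ _ (Fin.succ_lt_succ_iff.1 hij)
    · intro i
      induction i using Fin.cases
      · simpa using hr0
      · simpa using hMd _
    · ext i j
      rw [mul_apply]
      simp only [mul_diagonal, transpose_apply, of_apply, Fin.sum_univ_succ]
      induction i using Fin.cases with
      | zero =>
        induction j using Fin.cases with
        | zero =>
          simp only [Fin.cons_zero, Fin.cons_succ, Pi.zero_apply, zero_mul,
            Finset.sum_const_zero, add_zero]
          linarith
        | succ j =>
          simp only [Fin.cons_zero, Fin.cons_succ, Pi.zero_apply, zero_mul,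
            Finset.sum_const_zero, add_zero]
          rw [hA]
          field_simp
          linear_combination -(A j.succ 0) * hs0
      | succ i =>
        induction j using Fin.cases with
        | zero =>
          simp only [Fin.cons_zero, Fin.cons_succ, Pi.zero_apply, mul_zero,
            Finset.sum_const_zero, add_zero]
          field_simp
          linear_combination -(A i.succ 0) * hs0
        | succ j =>
          simp only [Fin.cons_zero, Fin.cons_succ]
          rw [← hfac', ← hsr]
          have hs0' : s 0 ≠ 0 := left_ne_zero_of_mul ha.ne'
          field_simp
          linear_combination (-(s 0 * s 0 + 1) * A i.succ 0 * A j.succ 0) * hs0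

lemma IsLowerTri.mul {k : ℕ} {A B : Matrix (Fin k) (Fin k) ℝ} (hA : IsLowerTri A)
    (hB : IsLowerTri B) : IsLowerTri (A * B) := by
  intro i j hij
  rw [mul_apply]
  refine Finset.sum_eq_zero fun l _ => ?_
  rcases lt_or_ge i l with h | h
  · rw [hA i l h, zero_mul]
  · rw [hB l j (h.trans_lt hij), mul_zero]

lemma IsLowerTri.posDiag_mul {k : ℕ} {A B : Matrix (Fin k) (Fin k) ℝ} (hA : IsLowerTri A)
    (hB : IsLowerTri B) (hAd : PosDiag A) (hBd : PosDiag B) : PosDiag (A * B) := by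
  intro i
  rw [mul_apply, Finset.sum_eq_single i]
  · exact mul_pos (hAd i) (hBd i)
  · intro l _ hl
    rcases lt_or_gt_of_ne hl with h | h
    · rw [hB l i h, mul_zero]
    · rw [hA i l h, zero_mul]
  · simp

lemma IsLowerTri.isUnit_det {k : ℕ} {A : Matrix (Fin k) (Fin k) ℝ} (hA : IsLowerTri A)
    (hAd : PosDiag A) : IsUnit A.det := by
  rw [det_of_isLowerTriangular A fun i j h => hA i j h]
  exact (Finset.prod_pos fun i _ => hAd i).ne'.isUnit

theorem stmt15 (m n : ℕ) (K dK Lt : Matrix (Fin (m + n)) (Fin (m + n)) ℝ) (ε : ℝ)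
    (hK : Kᵀ = K) (hdK : dKᵀ = dK) (hε : 0 ≤ ε)
    (hLt : IsLowerTri Lt) (hLtd : PosDiag Lt)
    (hfact : K + dK = Lt * Jmat m n * Ltᵀ)
    (hbound : ∀ i j, |dK i j| ≤ ε * (entAbs Lt * entAbs Ltᵀ) i j)
    (hsmall : condF Lt * condF (Lt⁻¹ᵀ) * ε < 1 / 2) :
    ∃ dL : Matrix (Fin (m + n)) (Fin (m + n)) ℝ,
      IsLowerTri (Lt - dL) ∧ PosDiag (Lt - dL) ∧
      K = (Lt - dL) * Jmat m n * (Lt - dL)ᵀ := by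
  have hu : IsUnit Lt.det := hLt.isUnit_det hLtd
  have huT : IsUnit Ltᵀ.det := by rwa [det_transpose]
  have hinvT : Lt⁻¹ᵀ⁻¹ = Ltᵀ := by
    rw [transpose_nonsing_inv, nonsing_inv_nonsing_inv _ huT]
  set E := Lt⁻¹ * dK * Lt⁻¹ᵀ with hE
  have hE_symm : Eᵀ = E := by
    simp only [hE, transpose_mul, transpose_transpose, hdK, Matrix.mul_assoc]
  have hE_abs (i j) : |E i j| ≤ ε * ((entAbs Lt⁻¹ * entAbs Lt) *
      (entAbs Ltᵀ * entAbs Lt⁻¹ᵀ)) i j := by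
    have h1 := abs_mul_apply_le (Lt⁻¹ * dK) Lt⁻¹ᵀ i j
    have h2 : ∀ i j, (entAbs Lt⁻¹ * entAbs dK) i j
        ≤ (entAbs Lt⁻¹ * (ε • (entAbs Lt * entAbs Ltᵀ))) i j :=
      mul_apply_le_mul_apply (entAbs_nonneg _) (entAbs_nonneg _) (fun _ _ => le_rfl) hbound
    have h3 := mul_apply_le_mul_apply (B := entAbs Lt⁻¹ᵀ)
      (fun i j => (abs_nonneg _).trans ((abs_mul_apply_le Lt⁻¹ dK i j).trans (h2 i j)))
      (entAbs_nonneg _)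
      (fun i j => (abs_mul_apply_le Lt⁻¹ dK i j).trans (h2 i j)) (fun _ _ => le_rfl) i j
    refine h1.trans (h3.trans_eq ?_)
    simp only [Matrix.mul_smul, Matrix.smul_mul, Matrix.smul_apply, smul_eq_mul, Matrix.mul_assoc]
  have hE_norm : frobNorm E < 1 := by
    have h := (frobNorm_le_of_abs_le hε hE_abs).trans
      (mul_le_mul_of_nonneg_left (frobNorm_mul_le _ _) hε)
    simp only [condF, hinvT] at hsmall
    linarith
  set s : Fin (m + n) → ℝ := fun i => if (i : ℕ) < m then 1 else -1 with hs_def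
  have hJ : Jmat m n = diagonal s := rfl
  have hs (i) : s i ^ 2 = 1 := by
    simp only [hs_def]
    split_ifs <;> norm_num
  obtain ⟨M, hM, hMd, hfac⟩ := exists_generalized_cholesky s hs (diagonal s - E)
    (fun i j => by
      have h : (diagonal s - E)ᵀ = diagonal s - E := by
        rw [transpose_sub, diagonal_transpose, hE_symm]
      exact (congrFun (congrFun h j) i))
    (fun x hx => by
      have hxpos : 0 < ∑ i, x i ^ 2 := by
        obtain ⟨i, hi⟩ := Function.ne_iff.1 hx
        exact Finset.sum_pos' (fun _ _ => sq_nonneg _)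
          ⟨i, Finset.mem_univ _, sq_pos_of_ne_zero hi⟩
      have h := sum_sign_mul_le s hs E x
      have heq : ∑ i, s i * x i * ((diagonal s - E) *ᵥ x) i
          = ∑ i, x i ^ 2 - ∑ i, s i * x i * (E *ᵥ x) i := by
        rw [← Finset.sum_sub_distrib]
        refine Finset.sum_congr rfl fun i _ => ?_
        rw [sub_mulVec, Pi.sub_apply, mulVec_diagonal]
        linear_combination x i ^ 2 * hs i
      rw [heq]
      nlinarith)
  refine ⟨Lt - Lt * M, ?_⟩
  rw [sub_sub_cancel]
  refine ⟨hLt.mul hM, hLt.posDiag_mul hM hLtd hMd, ?_⟩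
  have hLEL : Lt * E * Ltᵀ = dK := by
    rw [hE, transpose_nonsing_inv, ← Matrix.mul_assoc, mul_nonsing_inv_cancel_left _ _ hu,
      nonsing_inv_mul_cancel_right _ _ huT]
  calc K = Lt * (diagonal s - E) * Ltᵀ := by
        rw [Matrix.mul_sub, Matrix.sub_mul, hLEL, ← hJ, ← hfact, add_sub_cancel_right]
    _ = Lt * M * Jmat m n * (Lt * M)ᵀ := by
        rw [hfac, hJ, transpose_mul]
        simp only [Matrix.mul_assoc]
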